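/- For every ε > 0, every r ∈ [1,∞) and every v ∈ L^r(ℝ^d), the unfolded function (x,y) ↦ v(T_ε(x,y)) belongs to L^r(ℝ^d × Y) and ∫_{ℝ^d} ∫_Y |v(T_ε(x,y))|^r dy dx = ∫_{ℝ^d} |v(x)|^r dx; i.e., unfolding v ↦ v∘T_ε is a linear isometry from L^r(ℝ^d) into L^r(ℝ^d × Y). -/

import Mathlib

open MeasureTheory Filter Set

noncomputable section

/-- The unit cell `Y = (0,1]^d`. -/
def Ycell (d : ℕ) : Set (EuclideanSpace ℝ (Fin d)) :=
  {y | ∀ i, y i ∈ Set.Ioc (0 : ℝ) 1}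

/-- The componentwise floor map `N(x) = (⌊x₁⌋, …, ⌊x_d⌋)` (viewed in `ℝ^d`). -/
def Ncell {d : ℕ} (x : EuclideanSpace ℝ (Fin d)) : EuclideanSpace ℝ (Fin d) :=
  WithLp.toLp 2 fun i => (⌊x i⌋ : ℝ)

/-- The two-scale composition function `T_ε(x,y) = ε (N(x/ε) + y)`. -/
def Tcell {d : ℕ} (ε : ℝ) (x y : EuclideanSpace ℝ (Fin d)) :
    EuclideanSpace ℝ (Fin d) :=
  ε • (Ncell (ε⁻¹ • x) + y)

/-- The vector of `ℝ^d` with the integer coordinates `k`. -/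
def latticePoint {d : ℕ} (k : Fin d → ℤ) : EuclideanSpace ℝ (Fin d) :=
  WithLp.toLp 2 fun i => (k i : ℝ)

lemma measurableSet_Ycell (d : ℕ) : MeasurableSet (Ycell d) := by
  unfold Ycell
  simp only [Set.ofPred_forall]
  exact MeasurableSet.iInter fun i =>
    (by fun_prop : Measurable fun y : EuclideanSpace ℝ (Fin d) => y i) measurableSet_Ioc

lemma measurable_Ncell {d : ℕ} : Measurable (Ncell (d := d)) := by
  unfold Ncell
  refine (WithLp.measurable_toLp 2 _).comp (measurable_pi_lambda _ fun i => ?_)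
  have h : Measurable fun n : ℤ => (n : ℝ) := measurable_from_top
  exact h.comp (Int.measurable_floor.comp (by fun_prop))

lemma measurable_Tcell {d : ℕ} (ε : ℝ) :
    Measurable fun p : EuclideanSpace ℝ (Fin d) × EuclideanSpace ℝ (Fin d) =>
      Tcell ε p.1 p.2 := by
  unfold Tcell
  exact ((measurable_Ncell.comp (measurable_fst.const_smul ε⁻¹)).add measurable_snd).const_smul ε

/-- The set of points with componentwise floor `k`. -/
def floorCell {d : ℕ} (k : Fin d → ℤ) : Set (EuclideanSpace ℝ (Fin d)) :=
  {x | ∀ i, x i ∈ Set.Ico (k i : ℝ) (k i + 1)}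

lemma measurableSet_floorCell {d : ℕ} (k : Fin d → ℤ) : MeasurableSet (floorCell k) := by
  unfold floorCell
  simp only [Set.ofPred_forall]
  exact MeasurableSet.iInter fun i =>
    (by fun_prop : Measurable fun y : EuclideanSpace ℝ (Fin d) => y i) measurableSet_Ico

lemma volume_floorCell {d : ℕ} (k : Fin d → ℤ) : volume (floorCell k) = 1 := by
  have h : floorCell k = (WithLp.ofLp : EuclideanSpace ℝ (Fin d) → Fin d → ℝ) ⁻¹'
      (Set.univ.pi fun i => Set.Ico (k i : ℝ) (k i + 1)) := by
    ext x
    simp [floorCell]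
  rw [h, (PiLp.volume_preserving_ofLp (Fin d)).measure_preimage
    (MeasurableSet.univ_pi fun _ => measurableSet_Ico).nullMeasurableSet, Real.volume_pi_Ico]
  simp

lemma mem_floorCell_iff {d : ℕ} {k : Fin d → ℤ} {x : EuclideanSpace ℝ (Fin d)} :
    x ∈ floorCell k ↔ (fun i => ⌊x i⌋) = k := by
  simp [floorCell, funext_iff, Int.floor_eq_iff]

lemma Ncell_eq_of_mem_floorCell {d : ℕ} {k : Fin d → ℤ} {x : EuclideanSpace ℝ (Fin d)}
    (hx : x ∈ floorCell k) : Ncell x = latticePoint k := by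
  rw [← mem_floorCell_iff.1 hx]
  rfl

lemma mem_preimage_Ycell_iff {d : ℕ} {k : Fin d → ℤ} {x : EuclideanSpace ℝ (Fin d)} :
    -latticePoint k + x ∈ Ycell d ↔ (fun i => ⌈x i⌉ - 1) = k := by
  simp only [Ycell, latticePoint, Set.mem_ofPred_eq, funext_iff, sub_eq_iff_eq_add,
    Int.ceil_eq_iff, Set.mem_Ioc, PiLp.add_apply, PiLp.neg_apply]
  refine forall_congr' fun i => ?_
  push_cast
  constructor <;> rintro ⟨h₁, h₂⟩ <;> constructor <;> linarith

lemma lintegral_comp_Ncell {d : ℕ} (F : EuclideanSpace ℝ (Fin d) → ENNReal) :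
    ∫⁻ x, F (Ncell x) = ∑' k : Fin d → ℤ, F (latticePoint k) := by
  have hU : ⋃ k : Fin d → ℤ, floorCell k = Set.univ :=
    Set.eq_univ_of_forall fun x => Set.mem_iUnion.2 ⟨_, mem_floorCell_iff.2 rfl⟩
  rw [← setLIntegral_univ, ← hU, lintegral_iUnion measurableSet_floorCell]
  · refine tsum_congr fun k => ?_
    rw [setLIntegral_congr_fun (measurableSet_floorCell k) (g := fun _ => F (latticePoint k))
      fun x hx => by simp only [Ncell_eq_of_mem_floorCell hx]]
    simp [volume_floorCell]
  · intro k l hkl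
    exact Set.disjoint_left.2 fun x hk hl =>
      hkl ((mem_floorCell_iff.1 hk).symm.trans (mem_floorCell_iff.1 hl))

lemma lintegral_eq_tsum_Ycell {d : ℕ} (g : EuclideanSpace ℝ (Fin d) → ENNReal) :
    ∫⁻ x, g x = ∑' k : Fin d → ℤ, ∫⁻ y in Ycell d, g (latticePoint k + y) := by
  have hU : ⋃ k : Fin d → ℤ, (fun x => -latticePoint k + x) ⁻¹' Ycell d = Set.univ :=
    Set.eq_univ_of_forall fun x => Set.mem_iUnion.2 ⟨_, mem_preimage_Ycell_iff.2 rfl⟩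
  rw [← setLIntegral_univ, ← hU, lintegral_iUnion
    fun k => (measurable_const_add _) (measurableSet_Ycell d)]
  · refine tsum_congr fun k => ?_
    rw [← (measurePreserving_add_left volume (-latticePoint k)).setLIntegral_comp_preimage_emb
      (measurableEmbedding_addLeft _) (fun y => g (latticePoint k + y))]
    simp
  · intro k l hkl
    exact Set.disjoint_left.2 fun x hk hl =>
      hkl ((mem_preimage_Ycell_iff.1 hk).symm.trans (mem_preimage_Ycell_iff.1 hl))

lemma lintegral_comp_smul_of_pos {d : ℕ} {ε : ℝ} (hε : 0 < ε)
    (f : EuclideanSpace ℝ (Fin d) → ENNReal) :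
    ∫⁻ x, f (ε • x) = ENNReal.ofReal ((ε ^ d)⁻¹) * ∫⁻ x, f x := by
  have h := (measurableEmbedding_const_smul₀ hε.ne').lintegral_map (μ := volume) f
  rw [← h, Measure.map_addHaar_smul volume hε.ne', lintegral_smul_measure,
    finrank_euclideanSpace_fin, abs_of_pos (by positivity), smul_eq_mul]

lemma lintegral_lintegral_Tcell {d : ℕ} {ε : ℝ} (hε : 0 < ε)
    (f : EuclideanSpace ℝ (Fin d) → ENNReal) :
    ∫⁻ x, ∫⁻ y in Ycell d, f (Tcell ε x y) = ∫⁻ x, f x := by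
  unfold Tcell
  rw [lintegral_comp_smul_of_pos (inv_pos.2 hε)
      (fun x => ∫⁻ y in Ycell d, f (ε • (Ncell x + y))),
    lintegral_comp_Ncell (fun z => ∫⁻ y in Ycell d, f (ε • (z + y))),
    ← lintegral_eq_tsum_Ycell (fun z => f (ε • z)), lintegral_comp_smul_of_pos hε, ← mul_assoc,
    ← ENNReal.ofReal_mul (by positivity), inv_pow, inv_inv, mul_inv_cancel₀ (by positivity),
    ENNReal.ofReal_one, one_mul]

/-- The map `T_ε` sends the product of Lebesgue measures on `ℝ^d × Y` to that on `ℝ^d`. -/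
lemma measurePreserving_Tcell {d : ℕ} {ε : ℝ} (hε : 0 < ε) :
    MeasurePreserving (fun p : EuclideanSpace ℝ (Fin d) × EuclideanSpace ℝ (Fin d) =>
      Tcell ε p.1 p.2) (volume.prod (volume.restrict (Ycell d))) volume := by
  refine ⟨measurable_Tcell ε, Measure.ext_of_lintegral _ fun f hf => ?_⟩
  rw [lintegral_map hf (measurable_Tcell ε)]
  exact (lintegral_prod _ (hf.comp (measurable_Tcell ε)).aemeasurable).trans
    (lintegral_lintegral_Tcell hε f)

/-- unfolding is an isometry of `L^r`: for every `ε > 0`,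
`r ∈ [1,∞)` and `v ∈ L^r(ℝ^d)`, the unfolded function `(x,y) ↦ v(T_ε(x,y))`
belongs to `L^r(ℝ^d × Y)` and
`∫_{ℝ^d} ∫_Y |v(T_ε(x,y))|^r dy dx = ∫_{ℝ^d} |v(x)|^r dx`. -/
theorem stmt2 {d : ℕ} (hd : 1 ≤ d) (ε : ℝ) (hε : 0 < ε) (r : ℝ) (hr : 1 ≤ r)
    (v : EuclideanSpace ℝ (Fin d) → ℝ) (hvmeas : Measurable v)
    (hvLr : Integrable fun x => |v x| ^ r) :
    IntegrableOn
      (fun p : EuclideanSpace ℝ (Fin d) × EuclideanSpace ℝ (Fin d) =>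
        |v (Tcell ε p.1 p.2)| ^ r) (Set.univ ×ˢ Ycell d) ∧
    ∫ x : EuclideanSpace ℝ (Fin d), ∫ y in Ycell d, |v (Tcell ε x y)| ^ r =
      ∫ x : EuclideanSpace ℝ (Fin d), |v x| ^ r := by
  have hT := measurePreserving_Tcell (d := d) hε
  have hint := hT.integrable_comp_of_integrable hvLr
  refine ⟨?_, ?_⟩
  · rw [IntegrableOn, Measure.volume_eq_prod, ← Measure.prod_restrict, Measure.restrict_univ]
    exact hint
  · conv_rhs => rw [← hT.map_eq]
    rw [integral_map hT.measurable.aemeasurable (hT.map_eq.symm ▸ hvLr.aestronglyMeasurable)]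
    exact (integral_prod _ hint).symm
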